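/- Let G be a locally (soluble-by-finite) group with the property K̄∞. If the center Z(G) of G is infinite, then the commutator subgroup ⁅G,G⁆ of G is finite. -/

import Mathlib

/-- A group `G` has property K̄∞ if for every subgroup `X` of `G` the set of
subgroups of the form `⁅X, H⁆`, with `H` ranging over infinite subgroups of `G`,
is finite. -/
def PropKInf (G : Type*) [Group G] : Prop :=
  ∀ X : Subgroup G, {S : Subgroup G | ∃ H : Subgroup G, Infinite H ∧ S = ⁅X, H⁆}.Finite

/-- A group is locally (soluble-by-finite) if every finitely generated subgroup
contains a solvable subgroup of finite index. -/
def LocallySolubleByFinite (G : Type*) [Group G] : Prop :=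
  ∀ S : Subgroup G, S.FG → ∃ T : Subgroup S, IsSolvable T ∧ T.FiniteIndex

open scoped commutatorElement Pointwise

theorem aux_field (K : Type*) [Field K] [Module.Finite ℤ K] : Finite K := by
  have hint : Algebra.IsIntegral ℤ K := inferInstance
  have hni : ¬ Function.Injective (algebraMap ℤ K) := by
    intro h
    exact Int.not_isField (isField_of_isIntegral_of_isField h (Field.toIsField K))
  apply Module.finite_of_fg_torsion
  rw [injective_iff_map_eq_zero] at hni
  push Not at hni
  obtain ⟨n, hn, hn0⟩ := hni
  intro x
  refine ⟨⟨n, mem_nonZeroDivisors_of_ne_zero hn0⟩, ?_⟩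
  change n • x = 0
  rw [Algebra.smul_def, hn, zero_mul]

theorem aux_jac : IsJacobsonRing ℤ := by
  rw [isJacobsonRing_iff_prime_eq]
  intro P hP
  by_cases h : P = ⊥
  · subst h
    rw [eq_bot_iff]
    intro x hx
    rw [Ideal.mem_jacobson_bot] at hx
    have h1 := hx x
    rw [Int.isUnit_iff] at h1
    have h2 : x * x = 0 := by
      have := mul_self_nonneg x
      omega
    simpa using h2
  · have := hP.isMaximal h
    exact Ideal.jacobson_eq_self_of_isMaximal

theorem aux_simple (R S : Type*) [CommRing R] [Algebra.FiniteType ℤ R] [AddCommGroup S] [Module R S]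
    [IsSimpleModule R S] : Finite S := by
  obtain ⟨m, hm, ⟨e⟩⟩ := isSimpleModule_iff_quot_maximal.mp (inferInstance : IsSimpleModule R S)
  let _ := Ideal.Quotient.field m
  have : Algebra.FiniteType ℤ (R ⧸ m) := inferInstance
  have := aux_jac
  have : Module.Finite ℤ (R ⧸ m) := finite_of_finite_type_of_isJacobsonRing ℤ (R ⧸ m)
  have := aux_field (R ⧸ m)
  exact Finite.of_equiv _ e.symm.toEquiv

theorem aux_len (R M : Type*) [CommRing R] [Algebra.FiniteType ℤ R] [AddCommGroup M] [Module R M]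
    (h : IsFiniteLength R M) : Finite M := by
  induction h with
  | of_subsingleton => infer_instance
  | @of_simple_quotient M _ _ N _ _ ih =>
    have h2 : Finite (M ⧸ N) := aux_simple R (M ⧸ N)
    have h3 : Finite N.toAddSubgroup := ih
    have h4 : Finite (M ⧸ N.toAddSubgroup) := h2
    exact Finite.of_addSubgroup_quotient N.toAddSubgroup

theorem aux_fin (R M : Type*) [CommRing R] [Algebra.FiniteType ℤ R] [AddCommGroup M] [Module R M]
    [Finite (Submodule R M)] : Finite M := by
  apply aux_len R M
  rw [isFiniteLength_iff_isNoetherian_isArtinian]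
  exact ⟨isNoetherian_iff'.mpr inferInstance, inferInstanceAs (WellFoundedLT _)⟩

theorem aux_rep (R M : Type*) [CommRing R] [Algebra.FiniteType ℤ R] [AddCommGroup M]
    (ρ : R →+* AddMonoid.End M)
    (h : {W : AddSubgroup M | ∀ r, ∀ w ∈ W, ρ r w ∈ W}.Finite) : Finite M := by
  let _ : Module R M := Module.compHom M ρ
  have hfin : Finite (Submodule R M) := by
    have := h.to_subtype
    refine Finite.of_injective (β := {W : AddSubgroup M | ∀ r, ∀ w ∈ W, ρ r w ∈ W})
      (fun W => ⟨W.toAddSubgroup, fun r w hw => W.smul_mem r hw⟩) ?_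
    intro W V hWV
    exact Submodule.toAddSubgroup_injective (Subtype.ext_iff.mp hWV)
  exact aux_fin R M

theorem aux_pair (E : Type*) [Ring E] (a b : E) (hab : a * b = b * a) :
    ∃ (R : Type) (_ : CommRing R) (_ : Algebra.FiniteType ℤ R) (ρ : R →+* E),
      (∃ r, ρ r = a) ∧ (∃ r, ρ r = b) := by
  let f := Polynomial.eval₂RingHom' (Int.castRingHom E) a (fun n => Int.cast_commute n a)
  have hft : Algebra.FiniteType ℤ (Polynomial (Polynomial ℤ)) :=
    Algebra.FiniteType.trans (S := Polynomial ℤ) inferInstance inferInstance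
  refine ⟨Polynomial (Polynomial ℤ), inferInstance, hft,
    Polynomial.eval₂RingHom' f b ?_, ⟨Polynomial.C Polynomial.X, ?_⟩, ⟨Polynomial.X, ?_⟩⟩
  · intro p
    induction p using Polynomial.induction_on with
    | C n => simp [f]
    | add p q hp hq => rw [map_add]; exact hp.add_left hq
    | monomial n c _ =>
      have : f (Polynomial.C c * Polynomial.X ^ (n + 1)) = (c : E) * a ^ (n + 1) := by
        have e1 : f Polynomial.X = a := by simp [f, Polynomial.eval₂RingHom']
        have e2 : f (Polynomial.C c) = (c : E) := by simp [f]
        rw [map_mul, map_pow, e1, e2]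
      rw [this]
      exact (Int.cast_commute c b).mul_left (Commute.pow_left hab _)
  · simp [f, Polynomial.eval₂RingHom']
  · simp [Polynomial.eval₂RingHom']

theorem aux_aut (M : Type*) [AddCommGroup M] (t : M ≃+ M)
    (h : {W : AddSubgroup M | ∀ w ∈ W, t w ∈ W ∧ t.symm w ∈ W}.Finite) : Finite M := by
  obtain ⟨a, ha0⟩ : ∃ a : AddMonoid.End M, ∀ m, a m = t m := ⟨t.toAddMonoidHom, fun _ => rfl⟩
  obtain ⟨b, hb0⟩ : ∃ b : AddMonoid.End M, ∀ m, b m = t.symm m :=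
    ⟨t.symm.toAddMonoidHom, fun _ => rfl⟩
  have hab : a * b = b * a := by
    ext m
    simp [ha0, hb0]
  obtain ⟨R, _, _, ρ, ⟨r, hr⟩, ⟨q, hq⟩⟩ := aux_pair _ a b hab
  apply aux_rep R M ρ
  apply h.subset
  intro W hW w hw
  have h1 := hW r w hw
  have h2 := hW q w hw
  rw [hr, ha0] at h1
  rw [hq, hb0] at h2
  exact ⟨h1, h2⟩

theorem aux_grp {G : Type*} [Group G] (B : Subgroup G) (x : G) (hB : ⁅B, B⁆ = ⊥)
    (hx : ∀ b, b ∈ B ↔ x * b * x⁻¹ ∈ B)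
    (h : {W : Subgroup G | W ≤ B ∧ ∀ w, w ∈ W ↔ x * w * x⁻¹ ∈ W}.Finite) : Finite B := by
  have hcomm := Subgroup.commutator_self_eq_bot_iff.mp hB
  let _ : CommGroup B := { (inferInstance : Group B) with mul_comm := hcomm.is_comm.comm }
  let e : B ≃* B :=
    { toFun := fun b => ⟨x * b * x⁻¹, (hx _).mp b.2⟩
      invFun := fun b => ⟨x⁻¹ * b * x, (hx _).mpr (by simp [mul_assoc])⟩
      left_inv := fun b => by ext; simp [mul_assoc]
      right_inv := fun b => by ext; simp [mul_assoc]
      map_mul' := fun b c => by ext; simp [mul_assoc] }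
  have hfin : Finite (Additive B) := by
    apply aux_aut (Additive B) (MulEquiv.toAdditive e)
    have := h.to_subtype
    apply Set.Finite.of_finite_image (f := fun W : AddSubgroup (Additive B) =>
      (AddSubgroup.toSubgroup' W).map B.subtype)
    · apply h.subset
      rintro _ ⟨W, hW, rfl⟩
      refine ⟨Subgroup.map_subtype_le _, fun w => ⟨?_, ?_⟩⟩
      · rintro ⟨v, hv, rfl⟩
        exact ⟨e v, (hW _ hv).1, rfl⟩
      · rintro ⟨v, hv, hvw⟩
        refine ⟨e.symm v, (hW _ hv).2, ?_⟩
        change x⁻¹ * (v : G) * x = w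
        have : (v : G) = x * w * x⁻¹ := hvw
        rw [this]; group
    · intro W _ V _ hWV
      have := Subgroup.map_injective B.subtype_injective hWV
      exact AddSubgroup.toSubgroup'.injective this
  exact hfin

/-- The unrestricted property. -/
def PropK (G : Type*) [Group G] : Prop :=
  ∀ X : Subgroup G, {S : Subgroup G | ∃ H : Subgroup G, S = ⁅X, H⁆}.Finite

theorem propK_of (G : Type*) [Group G]
    (hG : PropKInf G) (hcen : Infinite (Subgroup.center G)) : PropK G := by
  intro X
  apply (hG X).subset
  rintro _ ⟨H, rfl⟩
  refine ⟨H ⊔ Subgroup.center G, ?_, ?_⟩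
  · exact Infinite.of_injective _
      (Subgroup.inclusion_injective (le_sup_right : Subgroup.center G ≤ H ⊔ Subgroup.center G))
  · apply le_antisymm (Subgroup.commutator_mono le_rfl le_sup_left)
    rw [Subgroup.commutator_le]
    intro a ha b hb
    obtain ⟨y, hy, z, hz, rfl⟩ := Subgroup.mem_sup_of_normal_right.mp hb
    have : ⁅a, y * z⁆ = ⁅a, y⁆ := by
      have h1 := Subgroup.mem_center_iff.mp hz
      have h2 : y * z * a⁻¹ = y * a⁻¹ * z := by rw [mul_assoc, ← h1, ← mul_assoc]
      simp only [commutatorElement_def]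
      calc a * (y * z) * a⁻¹ * (y * z)⁻¹ = a * (y * z * a⁻¹) * (z⁻¹ * y⁻¹) := by group
        _ = _ := by rw [h2]; group
    rw [this]
    exact Subgroup.commutator_mem_commutator ha hy

theorem propK_subgroup {G : Type*} [Group G] (hG : PropK G) (S : Subgroup G) : PropK S := by
  intro X
  apply Set.Finite.of_finite_image (f := fun W : Subgroup S => W.map S.subtype)
  · apply (hG (X.map S.subtype)).subset
    rintro _ ⟨_, ⟨H, rfl⟩, rfl⟩
    exact ⟨H.map S.subtype, Subgroup.map_commutator _ _ _⟩
  · intro W _ V _ h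
    exact Subgroup.map_injective S.subtype_injective h

theorem propK_quot {G : Type*} [Group G] (hG : PropK G) (N : Subgroup G) [N.Normal] :
    PropK (G ⧸ N) := by
  intro X
  apply ((hG (X.comap (QuotientGroup.mk' N))).image (Subgroup.map (QuotientGroup.mk' N))).subset
  rintro _ ⟨H, rfl⟩
  refine ⟨_, ⟨H.comap (QuotientGroup.mk' N), rfl⟩, ?_⟩
  rw [Subgroup.map_commutator, Subgroup.map_comap_eq_self_of_surjective
    (QuotientGroup.mk'_surjective N), Subgroup.map_comap_eq_self_of_surjective
    (QuotientGroup.mk'_surjective N)]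

theorem fin_of_quot {G : Type*} [Group G] (N : Subgroup G) [N.Normal] [Finite N]
    (h : Finite (commutator (G ⧸ N))) : Finite (commutator G) := by
  have h1 : (QuotientGroup.mk' N ⁻¹' (commutator (G ⧸ N) : Set (G ⧸ N))).Finite := by
    apply Set.Finite.preimage' (Set.toFinite _)
    intro b _
    obtain ⟨g, rfl⟩ := QuotientGroup.mk'_surjective N b
    apply ((Set.toFinite (N : Set G)).image (fun n => g * n)).subset
    intro y hy
    refine ⟨g⁻¹ * y, ?_, by simp⟩
    exact QuotientGroup.eq.mp (Eq.symm hy)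
  apply (h1.subset _).to_subtype
  intro y hy
  have : QuotientGroup.mk' N y ∈ (commutator G).map (QuotientGroup.mk' N) :=
    Subgroup.mem_map_of_mem _ hy
  rw [commutator_def, Subgroup.map_commutator] at this
  exact Subgroup.commutator_mono le_top le_top this

/-- if all `⁅⊤, ⟨x⟩⁆` are finite -/
theorem fin_of_all {G : Type*} [Group G] (hG : PropK G)
    (h : ∀ x : G, Finite ↥(⁅(⊤ : Subgroup G), Subgroup.zpowers x⁆ : Subgroup G)) : Finite (commutator G) := by
  have : (commutatorSet G).Finite := by
    have h1 := ((hG ⊤).subset (t := Set.range fun x : G => ⁅(⊤ : Subgroup G), Subgroup.zpowers x⁆)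
      (by rintro _ ⟨x, rfl⟩; exact ⟨_, rfl⟩)).biUnion (t := fun S => (S : Set G))
      (by rintro _ ⟨x, rfl⟩; exact @Set.toFinite _ _ (h x))
    apply h1.subset
    rintro _ ⟨a, b, rfl⟩
    simp only [Set.mem_iUnion]
    exact ⟨_, ⟨b, rfl⟩, Subgroup.commutator_mem_commutator (Subgroup.mem_top _) (Subgroup.mem_zpowers b)⟩
  have := this.to_subtype
  infer_instance

theorem schur {G : Type*} [Group G] (h : (Subgroup.center G).FiniteIndex) :
    Finite (commutator G) := by
  have : (commutatorSet G).Finite := by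
    have h1 : Finite (G ⧸ Subgroup.center G) := inferInstance
    apply (Set.finite_range (fun p : (G ⧸ Subgroup.center G) × (G ⧸ Subgroup.center G) =>
      ⁅p.1.out, p.2.out⁆)).subset
    rintro _ ⟨a, b, rfl⟩
    refine ⟨(a, b), ?_⟩
    obtain ⟨⟨z, hz⟩, hz'⟩ := QuotientGroup.mk_out_eq_mul (Subgroup.center G) a
    obtain ⟨⟨w, hw⟩, hw'⟩ := QuotientGroup.mk_out_eq_mul (Subgroup.center G) b
    simp only [hz', hw', commutatorElement_def]
    rw [Subgroup.mem_center_iff] at hz hw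
    have e1 : ∀ g, g * z = z * g := hz
    have e2 : ∀ g, g * w = w * g := hw
    rw [e1 a, e2 b]
    calc z * a * (w * b) * (z * a)⁻¹ * (w * b)⁻¹
        = z * ((a * w) * b * a⁻¹) * z⁻¹ * b⁻¹ * w⁻¹ := by group
      _ = (((a * w) * b * a⁻¹) * z) * z⁻¹ * b⁻¹ * w⁻¹ := by rw [e1]
      _ = w * (a * b * a⁻¹ * b⁻¹) * w⁻¹ := by rw [e2]; group
      _ = (a * b * a⁻¹ * b⁻¹) * w * w⁻¹ := by rw [e2]
      _ = _ := by group
  have := this.to_subtype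
  infer_instance

/-- key lemma -/
theorem key0 {G : Type*} [Group G] (hG : PropK G) (A : Subgroup G) [hA : A.Normal]
    (hc : ⁅A, A⁆ = ⊥) (x : G) : Finite (⁅A, Subgroup.zpowers x⁆ : Subgroup G) := by
  have hcc : ∀ a ∈ A, ∀ b ∈ A, a * b = b * a := fun a ha b hb =>
    commutatorElement_eq_one_iff_mul_comm.mp (by
      have := Subgroup.commutator_mem_commutator ha hb
      rwa [hc, Subgroup.mem_bot] at this)
  have hm : ∀ a ∈ A, ⁅x, a⁆ ∈ A := fun a ha =>
    A.mul_mem (hA.conj_mem a ha x) (A.inv_mem ha)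
  have hmul : ∀ a ∈ A, ∀ b ∈ A, ⁅x, a * b⁆ = ⁅x, a⁆ * ⁅x, b⁆ := fun a ha b hb => by
    have : ⁅x, a * b⁆ = ⁅x, a⁆ * (a * ⁅x, b⁆ * a⁻¹) := by
      simp only [commutatorElement_def]; group
    rw [this, hcc a ha _ (hm b hb)]; simp
  let φ : A →* G :=
    { toFun := fun a => ⁅x, (a : G)⁆
      map_one' := by simp
      map_mul' := fun a b => hmul a a.2 b b.2 }
  -- basic computation
  have hW : ∀ W : Subgroup G, W ≤ φ.range → (∀ w, w ∈ W ↔ x * w * x⁻¹ ∈ W) →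
      W = ⁅Subgroup.zpowers x, (W.comap φ).map A.subtype⁆ := by
    intro W hWB hWx
    apply le_antisymm
    · intro w hw
      obtain ⟨a, rfl⟩ := hWB hw
      exact Subgroup.commutator_mem_commutator (Subgroup.mem_zpowers x) ⟨a, hw, rfl⟩
    · rw [Subgroup.commutator_le]
      rintro y hy _ ⟨a, ha, rfl⟩
      have ha' : ⁅x, (a : G)⁆ ∈ W := ha
      rw [Subgroup.zpowers_eq_closure] at hy
      have : (∀ w, w ∈ W ↔ y * w * y⁻¹ ∈ W) ∧ ⁅y, (a : G)⁆ ∈ W := by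
        induction hy using Subgroup.closure_induction with
        | mem z hz => rw [Set.mem_singleton_iff] at hz; subst hz; exact ⟨hWx, ha'⟩
        | one => simp
        | mul u v _ _ hu hv =>
          constructor
          · intro w
            rw [hv.1, hu.1]; simp [mul_assoc]
          · have : ⁅u * v, (a : G)⁆ = (u * ⁅v, (a : G)⁆ * u⁻¹) * ⁅u, (a : G)⁆ := by
              simp only [commutatorElement_def]; group
            rw [this]
            exact W.mul_mem ((hu.1 _).mp hv.2) hu.2
        | inv u _ hu =>
          constructor
          · intro w
            rw [hu.1 (u⁻¹ * w * u⁻¹⁻¹)]; simp [mul_assoc]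
          · rw [hu.1]
            have : u * ⁅u⁻¹, (a : G)⁆ * u⁻¹ = ⁅u, (a : G)⁆⁻¹ := by
              simp only [commutatorElement_def]; group
            rw [this]; exact W.inv_mem hu.2
      exact this.2
  have hrA : φ.range ≤ A := by
    rintro _ ⟨a, rfl⟩
    exact hm a a.2
  have hconj : ∀ g a : G, x * ⁅g, a⁆ * x⁻¹ = ⁅x * g * x⁻¹, x * a * x⁻¹⁆ := fun g a => by
    simp only [commutatorElement_def]; group
  have hrx : ∀ w, w ∈ φ.range ↔ x * w * x⁻¹ ∈ φ.range := by
    intro w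
    constructor
    · rintro ⟨a, rfl⟩
      refine ⟨⟨x * a * x⁻¹, hA.conj_mem a a.2 x⟩, ?_⟩
      change ⁅x, x * (a : G) * x⁻¹⁆ = x * ⁅x, (a : G)⁆ * x⁻¹
      simp only [commutatorElement_def]; group
    · rintro ⟨a, ha⟩
      refine ⟨⟨x⁻¹ * a * x, by simpa using hA.conj_mem a a.2 x⁻¹⟩, ?_⟩
      change ⁅x, x⁻¹ * (a : G) * x⁆ = w
      have ha' : ⁅x, (a : G)⁆ = x * w * x⁻¹ := ha
      have : w = x⁻¹ * ⁅x, (a : G)⁆ * x := by rw [ha']; group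
      rw [this]
      simp only [commutatorElement_def]; group
  have hfin : Finite φ.range := by
    apply aux_grp φ.range x
    · rw [eq_bot_iff, ← hc]
      exact Subgroup.commutator_mono hrA hrA
    · exact hrx
    · apply (hG (Subgroup.zpowers x)).subset
      rintro W ⟨h1, h2⟩
      exact ⟨_, hW W h1 h2⟩
  have : ⁅A, Subgroup.zpowers x⁆ = φ.range := by
    rw [hW φ.range le_rfl hrx, Subgroup.commutator_comm]
    congr 1
    ext a
    constructor
    · intro ha
      exact ⟨⟨a, ha⟩, ⟨_, rfl⟩, rfl⟩
    · rintro ⟨a, _, rfl⟩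
      exact a.2
  rw [this]
  exact hfin

theorem fin_sSup {A : Type*} [CommGroup A] (s : Set (Subgroup A)) (hs : s.Finite)
    (h : ∀ S ∈ s, Finite S) : Finite (sSup s : Subgroup A) := by
  induction s, hs using Set.Finite.induction_on with
  | empty => rw [sSup_empty]; infer_instance
  | @insert a s _ _ ih =>
    rw [sSup_insert]
    have h1 : Finite a := h a (Set.mem_insert _ _)
    have h2 := ih fun S hS => h S (Set.mem_insert_of_mem _ hS)
    have h3 : ((a : Set A) * ((sSup s : Subgroup A) : Set A)).Finite :=
      Set.Finite.mul (Set.toFinite _) (@Set.toFinite _ _ h2)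
    apply (h3.subset _).to_subtype
    rw [Subgroup.mul_normal]

theorem key {G : Type*} [Group G] (hG : PropK G) (A : Subgroup G) [hA : A.Normal]
    (hc : ⁅A, A⁆ = ⊥) : Finite (⁅A, (⊤ : Subgroup G)⁆ : Subgroup G) := by
  have hcomm := Subgroup.commutator_self_eq_bot_iff.mp hc
  let _ : CommGroup A := { (inferInstance : Group A) with mul_comm := hcomm.is_comm.comm }
  let s : Set (Subgroup A) := Set.range fun x : G => ⁅A, Subgroup.zpowers x⁆.subgroupOf A
  have hle : ∀ x : G, ⁅A, Subgroup.zpowers x⁆ ≤ A := fun x => Subgroup.commutator_le_left _ _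
  have hs : s.Finite := by
    apply ((hG A).image fun S => S.subgroupOf A).subset
    rintro _ ⟨x, rfl⟩
    exact ⟨_, ⟨_, rfl⟩, rfl⟩
  have h1 : Finite (sSup s : Subgroup A) := by
    apply fin_sSup s hs
    rintro _ ⟨x, rfl⟩
    have := key0 hG A hc x
    exact Finite.of_equiv _ (Subgroup.subgroupOfEquivOfLe (hle x)).symm.toEquiv
  have h2 : ⁅A, (⊤ : Subgroup G)⁆ ≤ (sSup s : Subgroup A).map A.subtype := by
    rw [Subgroup.commutator_le]
    intro a ha g _
    have h3 : ⁅a, g⁆ ∈ ⁅A, Subgroup.zpowers g⁆ :=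
      Subgroup.commutator_mem_commutator ha (Subgroup.mem_zpowers g)
    refine ⟨⟨⁅a, g⁆, hle g h3⟩, ?_, rfl⟩
    have h4 : ⁅A, Subgroup.zpowers g⁆.subgroupOf A ≤ sSup s := le_sSup ⟨g, rfl⟩
    exact h4 (Subgroup.mem_subgroupOf.mpr h3)
  have h3 : Finite ((sSup s : Subgroup A).map A.subtype) :=
    (Set.Finite.image A.subtype (@Set.toFinite _ _ h1)).to_subtype
  exact Finite.of_injective _ (Subgroup.inclusion_injective h2)

theorem class2 {G : Type*} [Group G] (hG : PropK G) (h : commutator G ≤ Subgroup.center G) :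
    Finite (commutator G) := by
  apply fin_of_all hG
  intro x
  let A := Subgroup.zpowers x ⊔ Subgroup.center G
  have hA : A.Normal := by
    constructor
    intro a ha g
    have : g * a * g⁻¹ = ⁅g, a⁆ * a := by simp [commutatorElement_def]
    rw [this]
    exact A.mul_mem ((h.trans le_sup_right)
      (Subgroup.commutator_mem_commutator (Subgroup.mem_top _) (Subgroup.mem_top _))) ha
  have hc : ⁅A, A⁆ = ⊥ := by
    rw [Subgroup.commutator_eq_bot_iff_le_centralizer]
    apply sup_le
    · rw [Subgroup.zpowers_le, Subgroup.mem_centralizer_iff]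
      intro a ha
      obtain ⟨_, ⟨k, rfl⟩, z, hz, rfl⟩ := Subgroup.mem_sup_of_normal_right.mp ha
      rw [Subgroup.mem_center_iff] at hz
      have e : Commute (x ^ k) x := (Commute.refl x).zpow_left k
      simp only
      rw [mul_assoc, ← hz, ← mul_assoc, e.eq, mul_assoc]
    · exact Subgroup.center_le_centralizer _
  have := key hG A hc
  apply Finite.of_injective _ (Subgroup.inclusion_injective (K := ⁅A, (⊤ : Subgroup G)⁆) _)
  rw [Subgroup.commutator_comm]
  exact Subgroup.commutator_mono le_sup_left le_rfl

/-- reducing modulo `⁅A, G⁆` -/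
theorem quot_central {G : Type*} [Group G] (A : Subgroup G) [A.Normal] :
    A.map (QuotientGroup.mk' ⁅A, (⊤ : Subgroup G)⁆) ≤
      Subgroup.center (G ⧸ ⁅A, (⊤ : Subgroup G)⁆) := by
  rw [← Subgroup.commutator_top_right_eq_bot_iff_le_center,
    ← Subgroup.map_top_of_surjective _ (QuotientGroup.mk'_surjective ⁅A, (⊤ : Subgroup G)⁆),
    ← Subgroup.map_commutator, QuotientGroup.map_mk'_self]

theorem comm_le_map {G H : Type*} [Group G] [Group H] (f : G →* H)
    (hf : Function.Surjective f) : commutator H ≤ (commutator G).map f := by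
  rw [commutator_def, commutator_def, Subgroup.map_commutator, Subgroup.map_top_of_surjective _ hf]

theorem metab {G : Type*} [Group G] (hG : PropK G) (h : ⁅commutator G, commutator G⁆ = ⊥) :
    Finite (commutator G) := by
  have h1 := key hG (commutator G) h
  apply fin_of_quot ⁅commutator G, (⊤ : Subgroup G)⁆
  apply class2 (propK_quot hG _)
  refine le_trans ?_ (quot_central (commutator G))
  exact comm_le_map _ (QuotientGroup.mk'_surjective _)

theorem fi_map {G H : Type*} [Group G] [Group H] (N : Subgroup G) [hN : N.FiniteIndex]
    (f : G →* H) (hf : Function.Surjective f) : (N.map f).FiniteIndex :=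
  ⟨ne_zero_of_dvd_ne_zero hN.index_ne_zero (N.index_map_dvd hf)⟩

theorem abel_fin {G : Type*} [Group G] (hG : PropK G) (N : Subgroup G) [N.Normal]
    [hN : N.FiniteIndex] (h : ⁅N, N⁆ = ⊥) : Finite (commutator G) := by
  have h1 := key hG N h
  apply fin_of_quot ⁅N, (⊤ : Subgroup G)⁆
  apply schur
  have h2 : (N.map (QuotientGroup.mk' ⁅N, (⊤ : Subgroup G)⁆)).FiniteIndex :=
    fi_map N _ (QuotientGroup.mk'_surjective _)
  exact Subgroup.finiteIndex_of_le (quot_central N)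

theorem fin_comm_map {G : Type*} [Group G] (N : Subgroup G) (h : Finite (commutator N)) :
    Finite (⁅N, N⁆ : Subgroup G) := by
  rw [← Subgroup.map_subtype_commutator]
  exact (Set.Finite.image N.subtype (@Set.toFinite _ _ h)).to_subtype

theorem quot_comm {G : Type*} [Group G] (N : Subgroup G) [N.Normal] :
    ⁅N.map (QuotientGroup.mk' ⁅N, N⁆), N.map (QuotientGroup.mk' ⁅N, N⁆)⁆ = ⊥ := by
  rw [← Subgroup.map_commutator, QuotientGroup.map_mk'_self]

theorem ds_map {G : Type*} [Group G] (n : ℕ) :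
    (derivedSeries (commutator G) n).map (commutator G).subtype = derivedSeries G (n + 1) := by
  induction n with
  | zero =>
    rw [derivedSeries_zero, derivedSeries_one, ← MonoidHom.range_eq_map, Subgroup.range_subtype]
  | succ n ih =>
    rw [derivedSeries_succ, Subgroup.map_commutator, ih, ← derivedSeries_succ]

theorem solv (n : ℕ) : ∀ {G : Type*} [Group G], PropK G → derivedSeries G n = ⊥ →
    Finite (commutator G) := by
  induction n with
  | zero =>
    intro G _ _ h
    rw [derivedSeries_zero] at h
    have : commutator G = ⊥ := by rw [eq_bot_iff, ← h]; exact le_top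
    rw [this]; infer_instance
  | succ n ih =>
    intro G _ hG h
    have h1 : Finite (commutator (commutator G)) := by
      apply ih (propK_subgroup hG _)
      have := ds_map (G := G) n
      rw [h] at this
      exact (Subgroup.map_eq_bot_iff_of_injective _ (Subgroup.subtype_injective _)).mp this
    have h2 := fin_comm_map _ h1
    apply fin_of_quot ⁅commutator G, commutator G⁆
    apply metab (propK_quot hG _)
    have := quot_comm (commutator G)
    rw [eq_bot_iff, ← this]
    have h3 : commutator (G ⧸ ⁅commutator G, commutator G⁆) ≤
        (commutator G).map (QuotientGroup.mk' ⁅commutator G, commutator G⁆) :=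
      comm_le_map _ (QuotientGroup.mk'_surjective _)
    exact Subgroup.commutator_mono h3 h3

theorem solv_fin {G : Type*} [Group G] (hG : PropK G) (T : Subgroup G) (hT : Group.IsSolvable T)
    [T.FiniteIndex] : Finite (commutator G) := by
  let N := T.normalCore
  have hN : Group.IsSolvable N :=
    Group.isSolvable_of_isSolvable_injective (Subgroup.inclusion_injective T.normalCore_le)
  obtain ⟨n, hn⟩ := (Group.isSolvable_def N).mp hN
  have h1 := solv n (propK_subgroup hG N) hn
  have h2 := fin_comm_map _ h1
  apply fin_of_quot ⁅N, N⁆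
  have hfi : N.FiniteIndex := inferInstance
  have h3 : (N.map (QuotientGroup.mk' ⁅N, N⁆)).FiniteIndex :=
    fi_map N _ (QuotientGroup.mk'_surjective _)
  have h4 : (N.map (QuotientGroup.mk' ⁅N, N⁆)).Normal :=
    Subgroup.Normal.map inferInstance _ (QuotientGroup.mk'_surjective _)
  exact abel_fin (propK_quot hG _) _ (quot_comm N)

theorem stmt_11 (G : Type*) [Group G] (hloc : LocallySolubleByFinite G)
    (hG : PropKInf G) (hcen : Infinite (Subgroup.center G)) :
    Finite (commutator G) := by
  have hK := propK_of G hG hcen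
  apply fin_of_all hK
  intro x
  have hfin : {S : Subgroup G | ∃ F : Subgroup G, F.FG ∧ S = ⁅Subgroup.zpowers x, F⁆}.Finite :=
    (hK (Subgroup.zpowers x)).subset (by rintro _ ⟨F, _, rfl⟩; exact ⟨F, rfl⟩)
  obtain ⟨S, hS⟩ := hfin.exists_maximal ⟨_, ⊥, Subgroup.FG.bot, rfl⟩
  obtain ⟨F, hF, rfl⟩ := hS.prop
  have hx : (Subgroup.zpowers x).FG := ⟨{x}, by simp [Subgroup.zpowers_eq_closure]⟩
  have h1 : ⁅(⊤ : Subgroup G), Subgroup.zpowers x⁆ ≤ ⁅Subgroup.zpowers x, F⁆ := by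
    rw [Subgroup.commutator_comm, Subgroup.commutator_le]
    intro y hy g _
    have hg : (Subgroup.zpowers g).FG := ⟨{g}, by simp [Subgroup.zpowers_eq_closure]⟩
    have := hS.le_of_ge ⟨F ⊔ Subgroup.zpowers g, hF.sup hg, rfl⟩
      (Subgroup.commutator_mono le_rfl le_sup_left)
    exact this (Subgroup.commutator_mem_commutator hy
      ((le_sup_right : Subgroup.zpowers g ≤ F ⊔ Subgroup.zpowers g) (Subgroup.mem_zpowers g)))
  let P := Subgroup.zpowers x ⊔ F
  obtain ⟨T, hT, hTi⟩ := hloc P (hx.sup hF)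
  have h2 := fin_comm_map P (solv_fin (propK_subgroup hK P) T hT)
  have h3 := h1.trans (Subgroup.commutator_mono le_sup_left le_sup_right :
    ⁅Subgroup.zpowers x, F⁆ ≤ ⁅P, P⁆)
  exact Finite.of_injective _ (Subgroup.inclusion_injective h3)
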